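/- Let x and y be decisions and j < N an index such that r_i(x) = 0 and r_i(y) = 0 for all i < j, and r_j(y) > 0. Then the limit of f(x, λ) / f(y, λ) as λ → +∞ is strictly less than 1 if and only if r_j(x) < r_j(y). -/

import Mathlib

open Filter Finset

/-- If the coefficients of index `i < j` vanish, then `∑ i, l ^ (N - i) * a i` divided by
`l ^ (N - j)` tends to `a j`. -/
theorem tendsto_sum_pow_sub_mul_div_pow_sub {N : ℕ} (a : Fin N → ℝ) (j : Fin N)
    (ha : ∀ i < j, a i = 0) :
    Tendsto (fun l : ℝ => (∑ i, l ^ (N - i.val) * a i) / l ^ (N - j.val)) atTop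
      (nhds (a j)) := by
  have hterm : ∀ i ∈ (univ : Finset (Fin N)),
      Tendsto (fun l : ℝ => l ^ (N - i.val) * a i / l ^ (N - j.val)) atTop
        (nhds (if i = j then a i else 0)) := by
    intro i _
    rcases lt_trichotomy i j with hij | rfl | hij
    · simp [ha i hij]
    · rw [if_pos rfl]
      refine tendsto_const_nhds.congr' ?_
      filter_upwards [eventually_gt_atTop 0] with l hl
      field_simp
    · rw [if_neg hij.ne']
      have hlt : N - i.val < N - j.val := by
        have := i.isLt
        have : j.val < i.val := hij
        omega
      simpa [div_mul_eq_mul_div] using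
        (tendsto_pow_div_pow_atTop_zero (𝕜 := ℝ) hlt).mul_const (a i)
  simpa [Finset.sum_div] using tendsto_finsetSum _ hterm

/-- With `r i x = 0 = r i y` for all `i < j` and `r j y > 0`,
the limit `L` of `f x λ / f y λ` as `λ → +∞` satisfies `L < 1 ↔ r j x < r j y`. -/
theorem stmt3 {X : Type*} (N : ℕ) (hN : 0 < N) (r : Fin N → X → ℝ)
    (hr : ∀ i z, 0 ≤ r i z) (x y : X) (j : Fin N)
    (hx0 : ∀ i < j, r i x = 0) (hy0 : ∀ i < j, r i y = 0) (hyj : 0 < r j y)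
    (L : ℝ)
    (hL : Tendsto
      (fun l : ℝ =>
        (∑ i, l ^ (N - i.val) * r i x) / (∑ i, l ^ (N - i.val) * r i y))
      atTop (nhds L)) :
    L < 1 ↔ r j x < r j y := by
  have hquot := (tendsto_sum_pow_sub_mul_div_pow_sub (fun i => r i x) j hx0).div
    (tendsto_sum_pow_sub_mul_div_pow_sub (fun i => r i y) j hy0) hyj.ne'
  have hlim : L = r j x / r j y := by
    refine tendsto_nhds_unique hL (hquot.congr' ?_)
    filter_upwards [eventually_gt_atTop 0] with l hl
    exact div_div_div_cancel_right₀ (pow_pos hl _).ne' _ _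
  rw [hlim, div_lt_one hyj]
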